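/- Let P be the presentation ⟨a, b | b⁻¹aba⁻²⟩ (i.e. a^b = a² with a^b := b⁻¹ab). For every integer k > 0 there is a word u_k over {a,b} ∪ {a⁻¹,b⁻¹} of length at most 12 + 4·log₂ k such that u_k and a^k represent the same element of the group presented by P. -/

import Mathlib

/-! Words over an alphabet `A`: a letter `(x, true)` is the generator `x`,
and `(x, false)` is its formal inverse `x⁻¹`. -/

/-- A word over the alphabet `A ∪ A⁻¹`. -/
abbrev Word (A : Type*) := List (A × Bool)

namespace Word

/-- The formal inverse of a word. -/
def inv {A : Type*} (w : Word A) : Word A := (w.map fun p => (p.1, !p.2)).reverse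

/-- `w'` is a cyclic conjugate (cyclic permutation) of `w`. -/
def IsCyclicConj {A : Type*} (w w' : Word A) : Prop :=
  ∃ u v : Word A, w = u ++ v ∧ w' = v ++ u

end Word

/-- Moves (i)–(iii) on words with respect to a set `R` of relator words:
free reduction, free expansion, and application of a relator (replace a subword `u`
by `v` where some cyclic conjugate of `u * v⁻¹` lies in `R ∪ R⁻¹`). -/
inductive Move {A : Type*} (R : Set (Word A)) : Word A → Word A → Prop
  | freeReduce (u v : Word A) (x : A) (b : Bool) :
      Move R (u ++ (x, b) :: (x, !b) :: v) (u ++ v)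
  | freeExpand (u v : Word A) (x : A) (b : Bool) :
      Move R (u ++ v) (u ++ (x, b) :: (x, !b) :: v)
  | relator (p q u v z : Word A)
      (hz : Word.IsCyclicConj (u ++ Word.inv v) z) (hR : z ∈ R ∨ Word.inv z ∈ R) :
      Move R (p ++ u ++ q) (p ++ v ++ q)

/-- Moves (i)–(iv): moves (i)–(iii) together with cyclic conjugation. -/
inductive MoveC {A : Type*} (R : Set (Word A)) : Word A → Word A → Prop
  | of {w w' : Word A} : Move R w w' → MoveC R w w'
  | cyc {w w' : Word A} : Word.IsCyclicConj w w' → MoveC R w w'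

/-- Moves (i)–(v) on finite sequences of words: one of the moves (i)–(iv) applied to
one word of the sequence, or fragmentation of one word `u ++ v` into `u` and `v`. -/
inductive MoveF {A : Type*} (R : Set (Word A)) : List (Word A) → List (Word A) → Prop
  | of (l₁ l₂ : List (Word A)) {w w' : Word A} :
      MoveC R w w' → MoveF R (l₁ ++ w :: l₂) (l₁ ++ w' :: l₂)
  | frag (l₁ l₂ : List (Word A)) (u v : Word A) :
      MoveF R (l₁ ++ (u ++ v) :: l₂) (l₁ ++ u :: v :: l₂)

/-- A word is null-homotopic over the presentation with relator set `R` if it represents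
the identity of the presented group, i.e. lies in the normal closure of the relators. -/
def NullHomotopic {A : Type*} (R : Set (Word A)) (w : Word A) : Prop :=
  FreeGroup.mk w ∈ Subgroup.normalClosure (FreeGroup.mk '' R)

/-- `FLle R w L`: the word `w` can be converted to the empty word by moves (i)–(iii)
with every intermediate word of length at most `L`. -/
def FLle {A : Type*} (R : Set (Word A)) (w : Word A) (L : ℕ) : Prop :=
  ∃ (m : ℕ) (f : ℕ → Word A), f 0 = w ∧ f m = [] ∧
    (∀ i < m, Move R (f i) (f (i + 1))) ∧ ∀ i ≤ m, (f i).length ≤ L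

/-- `FFLle R w L`: the word `w` can be converted to the empty word by moves (i)–(iv)
with every intermediate word of length at most `L`. -/
def FFLle {A : Type*} (R : Set (Word A)) (w : Word A) (L : ℕ) : Prop :=
  ∃ (m : ℕ) (f : ℕ → Word A), f 0 = w ∧ f m = [] ∧
    (∀ i < m, MoveC R (f i) (f (i + 1))) ∧ ∀ i ≤ m, (f i).length ≤ L

/-- The total length of a finite sequence of words. -/
def totalLength {A : Type*} (l : List (Word A)) : ℕ := (l.map List.length).sum

/-- `FFFLle R w L`: the length-one sequence `(w)` can be converted to a sequence of empty
words by moves (i)–(v) with every intermediate sequence of total length at most `L`. -/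
def FFFLle {A : Type*} (R : Set (Word A)) (w : Word A) (L : ℕ) : Prop :=
  ∃ (m : ℕ) (f : ℕ → List (Word A)), f 0 = [w] ∧ (∀ u ∈ f m, u = ([] : Word A)) ∧
    (∀ i < m, MoveF R (f i) (f (i + 1))) ∧ ∀ i ≤ m, totalLength (f i) ≤ L

/-- An element `x` of the free group is a conjugate of a relator of `R` or of an inverse
of a relator. -/
def IsConjRelator {A : Type*} (R : Set (Word A)) (x : FreeGroup A) : Prop :=
  ∃ c ρ : FreeGroup A, (ρ ∈ FreeGroup.mk '' R ∨ ρ⁻¹ ∈ FreeGroup.mk '' R) ∧ x = c * ρ * c⁻¹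

/-- `AreaLe R g N`: in the free group, `g` is a product of at most `N` conjugates
of elements of `R ∪ R⁻¹`. -/
def AreaLe {A : Type*} (R : Set (Word A)) (g : FreeGroup A) (N : ℕ) : Prop :=
  ∃ l : List (FreeGroup A), l.length ≤ N ∧ (∀ x ∈ l, IsConjRelator R x) ∧ l.prod = g

/-- The number of occurrences in `w` of the letter `x` or its inverse. -/
def countLtr {A : Type*} [DecidableEq A] (x : A) (w : Word A) : ℕ :=
  (w.filter fun p => p.1 = x).length

/-- The filling length `FL(w)` of a null-homotopic word. -/
noncomputable def FLw {A : Type*} (R : Set (Word A)) (w : Word A) : ℕ :=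
  sInf {L | FLle R w L}

/-- The free filling length `FFL(w)` of a null-homotopic word. -/
noncomputable def FFLw {A : Type*} (R : Set (Word A)) (w : Word A) : ℕ :=
  sInf {L | FFLle R w L}

/-- The fragmenting free filling length `FFFL(w)` of a null-homotopic word. -/
noncomputable def FFFLw {A : Type*} (R : Set (Word A)) (w : Word A) : ℕ :=
  sInf {L | FFFLle R w L}

/-- The filling length function `FL : ℕ → ℕ` of the presentation with relators `R`. -/
noncomputable def FLfn {A : Type*} (R : Set (Word A)) (n : ℕ) : ℕ :=
  sSup (FLw R '' {w | NullHomotopic R w ∧ w.length ≤ n})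

/-- The free filling length function `FFL : ℕ → ℕ`. -/
noncomputable def FFLfn {A : Type*} (R : Set (Word A)) (n : ℕ) : ℕ :=
  sSup (FFLw R '' {w | NullHomotopic R w ∧ w.length ≤ n})

/-- The fragmenting free filling length function `FFFL : ℕ → ℕ`. -/
noncomputable def FFFLfn {A : Type*} (R : Set (Word A)) (n : ℕ) : ℕ :=
  sSup (FFFLw R '' {w | NullHomotopic R w ∧ w.length ≤ n})

/-! The presentation `Q = ⟨a, b, r, s, t | a^b a⁻², [t,a], [r,at], [r,s], [s,t]⟩`. -/

/-- The five generators of the presentation `Q`. -/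
inductive QGen | a | b | r | s | t
deriving DecidableEq

/-- The five relators of `Q`: `b⁻¹aba⁻¹a⁻¹`, `t⁻¹a⁻¹ta`, `r⁻¹t⁻¹a⁻¹rat`,
`r⁻¹s⁻¹rs`, `s⁻¹t⁻¹st`. -/
def QRels : Set (Word QGen) :=
  { [(QGen.b, false), (QGen.a, true), (QGen.b, true), (QGen.a, false), (QGen.a, false)],
    [(QGen.t, false), (QGen.a, false), (QGen.t, true), (QGen.a, true)],
    [(QGen.r, false), (QGen.t, false), (QGen.a, false), (QGen.r, true), (QGen.a, true),
      (QGen.t, true)],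
    [(QGen.r, false), (QGen.s, false), (QGen.r, true), (QGen.s, true)],
    [(QGen.s, false), (QGen.t, false), (QGen.s, true), (QGen.t, true)] }

/-- The word `bⁿ`. -/
def bpow (n : ℕ) : Word QGen := List.replicate n (QGen.b, true)

/-- The word `b⁻ⁿ`. -/
def bpowInv (n : ℕ) : Word QGen := List.replicate n (QGen.b, false)

/-- The word `a^{-bⁿ} = b⁻ⁿ a⁻¹ bⁿ`. -/
def aConjNeg (n : ℕ) : Word QGen := bpowInv n ++ [(QGen.a, false)] ++ bpow n

/-- The word `a^{bⁿ} = b⁻ⁿ a bⁿ`. -/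
def aConjPos (n : ℕ) : Word QGen := bpowInv n ++ [(QGen.a, true)] ++ bpow n

/-- The word `a^{-bⁿ} r a^{bⁿ}`. -/
def gword (n : ℕ) : Word QGen := aConjNeg n ++ [(QGen.r, true)] ++ aConjPos n

/-- The word `w_n = [s, a^{-bⁿ} r a^{bⁿ}] = s⁻¹ (b⁻ⁿa⁻¹bⁿ r b⁻ⁿabⁿ)⁻¹ s (b⁻ⁿa⁻¹bⁿ r b⁻ⁿabⁿ)`. -/
def wn (n : ℕ) : Word QGen :=
  [(QGen.s, false)] ++ Word.inv (gword n) ++ [(QGen.s, true)] ++ gword n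

/-- The word `a^{-bⁿ} r a^{bⁿ} r a^{bⁿ} r⁻¹ a^{-bⁿ}`. -/
def g'word (n : ℕ) : Word QGen :=
  aConjNeg n ++ [(QGen.r, true)] ++ aConjPos n ++ [(QGen.r, true)] ++ aConjPos n ++
    [(QGen.r, false)] ++ aConjNeg n

/-- The word `w'_n = [s, a^{-bⁿ} r a^{bⁿ} r a^{bⁿ} r⁻¹ a^{-bⁿ}]`. -/
def w'n (n : ℕ) : Word QGen :=
  [(QGen.s, false)] ++ Word.inv (g'word n) ++ [(QGen.s, true)] ++ g'word n

/-- The two generators of the Baumslag–Solitar presentation `⟨a, b | b⁻¹aba⁻²⟩`. -/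
inductive BGen | a | b
deriving DecidableEq

/-- The relator `b⁻¹aba⁻¹a⁻¹` of `⟨a, b | b⁻¹aba⁻²⟩`. -/
def BRels : Set (Word BGen) :=
  { [(BGen.b, false), (BGen.a, true), (BGen.b, true), (BGen.a, false), (BGen.a, false)] }

/-- In a group with `b⁻¹ a b = a²`, each positive power of `a` is the value of a word whose length
is logarithmic in the exponent, read off from the binary expansion of the exponent. -/
theorem exists_word_map_eq_pow {G : Type*} [Group G] (f : FreeGroup BGen →* G)
    (h : (f (.of .b))⁻¹ * f (.of .a) * f (.of .b) = f (.of .a) ^ 2) {k : ℕ} (hk : 0 < k) :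
    ∃ u : Word BGen, u.length ≤ 1 + 3 * Nat.log 2 k ∧
      f (FreeGroup.mk u) = f (.of .a) ^ k := by
  induction k using Nat.strong_induction_on with
  | _ k ih =>
  obtain rfl | hk2 : k = 1 ∨ 2 ≤ k := by omega
  · exact ⟨[(.a, true)], by simp, by rw [pow_one]; rfl⟩
  obtain ⟨v, hv, hfv⟩ := ih (k / 2) (by omega) (by omega)
  have hlog : Nat.log 2 k = Nat.log 2 (k / 2) + 1 := Nat.log_of_one_lt_of_le one_lt_two hk2
  have hconj : (f (.of .b))⁻¹ * f (.of .a) ^ (k / 2) * f (.of .b) =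
      f (.of .a) ^ (2 * (k / 2)) := by
    simpa [h, pow_mul] using (conj_pow (i := k / 2) (a := (f (.of .b))⁻¹) (b := f (.of .a))).symm
  have hword : f (FreeGroup.mk ((.b, false) :: v ++ [(.b, true)])) =
      f (.of .a) ^ (2 * (k / 2)) := by
    rw [← hconj, ← hfv, ← map_inv, ← map_mul, ← map_mul]
    simp [FreeGroup.of, FreeGroup.invRev]
  obtain hmod | hmod : k = 2 * (k / 2) ∨ k = 2 * (k / 2) + 1 := by omega
  · exact ⟨(.b, false) :: v ++ [(.b, true)], by simp; omega, by rw [hword, ← hmod]⟩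
  · refine ⟨(.b, false) :: v ++ [(.b, true)] ++ [(.a, true)], by simp; omega, ?_⟩
    rw [← FreeGroup.mul_mk, map_mul, hword]
    conv_rhs => rw [hmod, pow_succ]
    rfl

theorem exists_short_word_for_a_pow (k : ℕ) (hk : 0 < k) :
    ∃ u : Word BGen, (u.length : ℝ) ≤ 12 + 4 * Real.logb 2 k ∧
      FreeGroup.mk u * (FreeGroup.mk (List.replicate k ((BGen.a, true) : BGen × Bool)))⁻¹ ∈
        Subgroup.normalClosure (FreeGroup.mk '' BRels) := by
  let N := Subgroup.normalClosure (FreeGroup.mk '' BRels)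
  have hrel : (QuotientGroup.mk' N (.of .b))⁻¹ * QuotientGroup.mk' N (.of .a) *
      QuotientGroup.mk' N (.of .b) = QuotientGroup.mk' N (.of .a) ^ 2 := by
    rw [← mul_inv_eq_one, ← map_inv, ← map_mul, ← map_mul, ← map_pow, ← map_inv, ← map_mul,
      ← MonoidHom.mem_ker, QuotientGroup.ker_mk']
    refine Subgroup.subset_normalClosure ⟨_, rfl, ?_⟩
    simp [FreeGroup.of, FreeGroup.invRev, pow_two]
  obtain ⟨u, hu, hfu⟩ := exists_word_map_eq_pow (QuotientGroup.mk' N) hrel hk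
  refine ⟨u, ?_, ?_⟩
  · have hlen : (u.length : ℝ) ≤ 1 + 3 * Nat.log 2 k := by exact_mod_cast hu
    have hlog : (Nat.log 2 k : ℝ) ≤ Real.logb 2 k := by exact_mod_cast Real.natLog_le_logb k 2
    have hlog_nonneg : (0 : ℝ) ≤ Nat.log 2 k := by positivity
    linarith
  · change _ ∈ N
    have hpow : FreeGroup.mk (List.replicate k ((BGen.a, true) : BGen × Bool)) =
        FreeGroup.of BGen.a ^ k := by
      simp [FreeGroup.of, FreeGroup.pow_mk]
    rw [hpow, ← QuotientGroup.ker_mk' N, MonoidHom.mem_ker, map_mul, map_inv, map_pow, hfu,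
      mul_inv_cancel]
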